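/- Let K be a field of characteristic zero and Q a forest poset. For a ∈ Q let v_a := Σ_{b ∈ Q, a ≼ b} ε_b ∈ K^Q, where (ε_b) is the standard basis of K^Q, and for u, w ∈ K^Q and i ∈ {1,2} let u ∘_i w := Σ_{c,d ∈ Q} u_c·w_d·e(c,i,d) ∈ V. Then the annihilator R_Q^⊥ of the relation space R_Q with respect to the bilinear form ⟨·,·⟩ is spanned by the elements v_a ∘₁ v_a − v_a ∘₂ v_a for a ∈ Q, together with the elements v_c ∘₁ v_d and v_c ∘₂ v_d for all incomparable c, d ∈ Q. -/

import Mathlib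

open scoped Classical

/-- The minimum of two comparable elements of a poset. -/
noncomputable def pmin {Q : Type*} [PartialOrder Q] (a b : Q) : Q :=
  if a ≤ b then a else b

/-- The standard basis vector `e(a,i,b)` of `V = (Q × {1,2} × Q) → K` (with `0 : Fin 2`
encoding position `1` and `1 : Fin 2` encoding position `2`). -/
noncomputable def e (K : Type*) [Field K] {Q : Type*} (a : Q) (i : Fin 2) (b : Q) :
    (Q × Fin 2 × Q) → K :=
  fun p => if p = (a, i, b) then 1 else 0

/-- The space of relations `R_Q` of the operad `As(Q)`. -/
noncomputable def relSpace (K : Type*) [Field K] (Q : Type*) [PartialOrder Q] :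
    Submodule K ((Q × Fin 2 × Q) → K) :=
  Submodule.span K
    {x | ∃ a b : Q, (a ≤ b ∨ b ≤ a) ∧
      (x = e K a 0 b - e K (pmin a b) 1 (pmin a b) ∨
       x = e K (pmin a b) 0 (pmin a b) - e K a 1 b)}

/-- The bilinear form on `V` with `⟨e(a,i,b), e(a',i',b')⟩ = 1` if `(a,b) = (a',b')` and
`i = i' = 1`, `= −1` if `(a,b) = (a',b')` and `i = i' = 2`, and `0` otherwise. -/
noncomputable def bform {K : Type*} [Field K] {Q : Type*} [Fintype Q]
    (u w : (Q × Fin 2 × Q) → K) : K :=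
  ∑ a : Q, ∑ b : Q, (u (a, 0, b) * w (a, 0, b) - u (a, 1, b) * w (a, 1, b))

lemma bform_add {K : Type*} [Field K] {Q : Type*} [Fintype Q]
    (r u v : (Q × Fin 2 × Q) → K) :
    bform r (u + v) = bform r u + bform r v := by
  unfold bform
  rw [← Finset.sum_add_distrib]
  refine Finset.sum_congr rfl fun a _ => ?_
  rw [← Finset.sum_add_distrib]
  refine Finset.sum_congr rfl fun b _ => ?_
  simp only [Pi.add_apply]
  ring

lemma bform_smul {K : Type*} [Field K] {Q : Type*} [Fintype Q]
    (c : K) (r v : (Q × Fin 2 × Q) → K) :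
    bform r (c • v) = c * bform r v := by
  unfold bform
  rw [Finset.mul_sum]
  refine Finset.sum_congr rfl fun a _ => ?_
  rw [Finset.mul_sum]
  refine Finset.sum_congr rfl fun b _ => ?_
  simp only [Pi.smul_apply, smul_eq_mul]
  ring

/-- The annihilator `S^⊥ = {v ∈ V : ⟨r, v⟩ = 0 for all r ∈ S}` of a subspace `S` of `V`
with respect to the bilinear form `⟨·,·⟩`. -/
noncomputable def annih (K : Type*) [Field K] (Q : Type*) [Fintype Q]
    (S : Submodule K ((Q × Fin 2 × Q) → K)) : Submodule K ((Q × Fin 2 × Q) → K) where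
  carrier := {v | ∀ r ∈ S, bform r v = 0}
  add_mem' := by
    intro u v hu hv r hr
    rw [bform_add, hu r hr, hv r hr, add_zero]
  zero_mem' := by
    intro r hr
    simp [bform]
  smul_mem' := by
    intro c v hv r hr
    rw [bform_smul, hv r hr, mul_zero]

/-- A forest poset: for all `a b c`, if `a ≼ c` and `b ≼ c` then `a` and `b` are
comparable. -/
def IsForestPoset (Q : Type*) [PartialOrder Q] : Prop :=
  ∀ a b c : Q, a ≤ c → b ≤ c → a ≤ b ∨ b ≤ a

/-- The vector `v_a = Σ_{a ≼ b} ε_b ∈ K^Q`. -/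
noncomputable def vv (K : Type*) [Field K] {Q : Type*} [PartialOrder Q] (a : Q) :
    Q → K :=
  fun b => if a ≤ b then 1 else 0

/-- For `u, w ∈ K^Q` and a position `i`, the element
`u ∘_i w = Σ_{c,d} u_c·w_d·e(c,i,d)` of `V`. -/
noncomputable def comp (K : Type*) [Field K] {Q : Type*} (i : Fin 2) (u w : Q → K) :
    (Q × Fin 2 × Q) → K :=
  fun p => if p.2.1 = i then u p.1 * w p.2.2 else 0

lemma bform_comm' {K : Type*} [Field K] {Q : Type*} [Fintype Q]
    (u w : (Q × Fin 2 × Q) → K) : bform u w = bform w u := by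
  unfold bform
  refine Finset.sum_congr rfl fun a _ => Finset.sum_congr rfl fun b _ => ?_
  ring

lemma bform_e0 {K : Type*} [Field K] {Q : Type*} [Fintype Q] (a b : Q)
    (v : (Q × Fin 2 × Q) → K) : bform v (e K a 0 b) = v (a, 0, b) := by
  unfold bform e
  rw [Finset.sum_eq_single a, Finset.sum_eq_single b] <;> simp +contextual

lemma bform_e1 {K : Type*} [Field K] {Q : Type*} [Fintype Q] (a b : Q)
    (v : (Q × Fin 2 × Q) → K) : bform v (e K a 1 b) = - v (a, 1, b) := by
  unfold bform e
  rw [Finset.sum_eq_single a, Finset.sum_eq_single b] <;> simp +contextual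

lemma bform_sub' {K : Type*} [Field K] {Q : Type*} [Fintype Q]
    (r u v : (Q × Fin 2 × Q) → K) :
    bform r (u - v) = bform r u - bform r v := by
  have h : u - v = u + (-1 : K) • v := by simp [sub_eq_add_neg]
  rw [h, bform_add, bform_smul]; ring

lemma mem_annih_rel {K Q : Type*} [Field K] [Fintype Q] [PartialOrder Q]
    (v : (Q × Fin 2 × Q) → K) :
    v ∈ annih K Q (relSpace K Q) ↔ ∀ a b : Q, (a ≤ b ∨ b ≤ a) →
      v (a, 0, b) + v (pmin a b, 1, pmin a b) = 0 ∧
      v (pmin a b, 0, pmin a b) + v (a, 1, b) = 0 := by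
  constructor
  · intro h a b hab
    constructor
    · have := h _ (Submodule.subset_span ⟨a, b, hab, Or.inl rfl⟩)
      rw [bform_comm', bform_sub', bform_e0, bform_e1] at this
      simpa using this
    · have := h _ (Submodule.subset_span ⟨a, b, hab, Or.inr rfl⟩)
      rw [bform_comm', bform_sub', bform_e0, bform_e1] at this
      simpa using this
  · intro h r hr
    rw [bform_comm']
    unfold relSpace at hr
    induction hr using Submodule.span_induction with
    | mem x hx =>
      obtain ⟨a, b, hab, rfl | rfl⟩ := hx
      · rw [bform_sub', bform_e0, bform_e1]; simpa using (h a b hab).1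
      · rw [bform_sub', bform_e0, bform_e1]; simpa using (h a b hab).2
    | zero => simp [bform]
    | add x y _ _ hx hy => rw [bform_add, hx, hy, add_zero]
    | smul c x _ hx => rw [bform_smul, hx, mul_zero]

lemma moebius_mem {K V P : Type*} [Field K] [AddCommGroup V] [Module K V] [Fintype P]
    [PartialOrder P] (S : Submodule K V) (U : P → Prop) (hU : ∀ a b, U a → a ≤ b → U b)
    (w : P → V) (h : ∀ a, U a → ∑ b ∈ Finset.univ.filter (fun b => a ≤ b), w b ∈ S) :
    ∀ a, U a → w a ∈ S := by
  intro a
  induction a using (wellFounded_gt (α := P)).induction with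
  | _ a ih =>
    intro ha
    have h1 := h a ha
    rw [← Finset.add_sum_erase _ _ (show a ∈ Finset.univ.filter (fun b => a ≤ b) by simp)] at h1
    refine (Submodule.add_mem_iff_left _ (Submodule.sum_mem _ fun b hb => ?_)).1 h1
    simp only [Finset.mem_erase, Finset.mem_filter, Finset.mem_univ, true_and] at hb
    exact ih b (lt_of_le_of_ne hb.2 (Ne.symm hb.1)) (hU _ _ ha hb.2)

lemma comp_vv_eq {K Q : Type*} [Field K] [Fintype Q] [PartialOrder Q] (i : Fin 2) (c d : Q) :
    ∑ p ∈ Finset.univ.filter (fun p : Q × Q => (c, d) ≤ p), e K p.1 i p.2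
      = comp K i (vv K c) (vv K d) := by
  funext ⟨x, j, y⟩
  rw [Finset.sum_apply, Finset.sum_filter, Finset.sum_eq_single (x, y)]
  · simp only [e, comp, vv, Prod.mk_le_mk, Prod.mk.injEq, true_and, and_true]
    split_ifs <;> simp_all
  · rintro ⟨b1, b2⟩ _ hb
    simp only [e, Prod.mk.injEq]
    rw [if_neg (c := x = b1 ∧ _)]
    · simp
    · rintro ⟨rfl, -, rfl⟩; exact hb rfl
  · simp

/-- The part of the annihilator attached to `a`. -/
noncomputable def ww (K : Type*) [Field K] {Q : Type*} [PartialOrder Q] (a : Q) :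
    (Q × Fin 2 × Q) → K :=
  fun p => if pmin p.1 p.2.2 = a then (if p.2.1 = 0 then 1 else -1) else 0

lemma sum_ww {K Q : Type*} [Field K] [Fintype Q] [PartialOrder Q] (f : Q → K)
    (x y : Q) (i : Fin 2) :
    ∑ b, f b * ww K b (x, i, y) = f (pmin x y) * (if i = 0 then 1 else -1) := by
  simp [ww]

lemma le_pmin {Q : Type*} [PartialOrder Q] {a x y : Q} (h : x ≤ y ∨ y ≤ x) :
    a ≤ pmin x y ↔ a ≤ x ∧ a ≤ y := by
  unfold pmin
  split_ifs with h1
  · exact ⟨fun h => ⟨h, h.trans h1⟩, fun h => h.1⟩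
  · have h2 := h.resolve_left h1
    exact ⟨fun h => ⟨h.trans h2, h⟩, fun h => h.2⟩

lemma pmin_self' {Q : Type*} [PartialOrder Q] (a : Q) : pmin a a = a := by simp [pmin]

/-- For a forest poset `Q`, the annihilator `R_Q^⊥` of the relation space with respect
to the bilinear form is spanned by the elements `v_a ∘₁ v_a − v_a ∘₂ v_a` for `a ∈ Q`
together with the elements `v_c ∘₁ v_d` and `v_c ∘₂ v_d` for incomparable `c, d ∈ Q`. -/
theorem annihilator_relSpace_forest_spanned {K Q : Type*} [Field K] [CharZero K]
    [Fintype Q] [PartialOrder Q] (hQ : IsForestPoset Q) :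
    annih K Q (relSpace K Q) = Submodule.span K
      ({x | ∃ a : Q, x = comp K 0 (vv K a) (vv K a) - comp K 1 (vv K a) (vv K a)} ∪
       {x | ∃ c d : Q, (¬ c ≤ d ∧ ¬ d ≤ c) ∧
          (x = comp K 0 (vv K c) (vv K d) ∨ x = comp K 1 (vv K c) (vv K d))}) := by
  apply le_antisymm
  · set S := Submodule.span K
      ({x | ∃ a : Q, x = comp K 0 (vv K a) (vv K a) - comp K 1 (vv K a) (vv K a)} ∪
       {x | ∃ c d : Q, (¬ c ≤ d ∧ ¬ d ≤ c) ∧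
          (x = comp K 0 (vv K c) (vv K d) ∨ x = comp K 1 (vv K c) (vv K d))}) with hS
    have h1 : ∀ i : Fin 2, ∀ p : Q × Q, (¬ p.1 ≤ p.2 ∧ ¬ p.2 ≤ p.1) → e K p.1 i p.2 ∈ S := by
      intro i
      refine moebius_mem S (fun p : Q × Q => ¬ p.1 ≤ p.2 ∧ ¬ p.2 ≤ p.1) ?_ _ ?_
      · rintro ⟨a, b⟩ ⟨c, d⟩ ⟨h1, h2⟩ ⟨h3, h4⟩
        simp only at h1 h2 h3 h4 ⊢
        constructor
        · intro h
          rcases hQ a b d (h3.trans h) h4 with h | h <;> contradiction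
        · intro h
          rcases hQ a b c h3 (h4.trans h) with h | h <;> contradiction
      · rintro ⟨c, d⟩ hcd
        have hc := comp_vv_eq (K := K) i c d
        convert (?_ : comp K i (vv K c) (vv K d) ∈ S) using 1
        · convert hc
        refine Submodule.subset_span (Or.inr ⟨c, d, hcd, ?_⟩)
        fin_cases i <;> simp
    have h2 : ∀ z : (Q × Fin 2 × Q) → K,
        (∀ x i y, (x ≤ y ∨ y ≤ x) → z (x, i, y) = 0) → z ∈ S := by
      intro z hz
      have : z = ∑ p : Q × Fin 2 × Q, z p • e K p.1 p.2.1 p.2.2 := by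
        funext q
        simp [Finset.sum_apply, e]
      rw [this]
      refine Submodule.sum_mem _ fun p _ => ?_
      obtain ⟨x, i, y⟩ := p
      by_cases h : x ≤ y ∨ y ≤ x
      · rw [hz x i y h]; simp
      · exact Submodule.smul_mem _ _ (h1 i (x, y) (not_or.1 h))
    have h3 : ∀ a : Q, ww K a ∈ S := by
      intro a
      refine moebius_mem S (fun _ => True) (fun _ _ _ _ => trivial) (ww K) ?_ a trivial
      intro a _
      have hg : comp K 0 (vv K a) (vv K a) - comp K 1 (vv K a) (vv K a) ∈ S :=
        Submodule.subset_span (Or.inl ⟨a, rfl⟩)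
      rw [← Submodule.sub_mem_iff_left S hg]
      apply h2
      intro x i y hxy
      have := sum_ww (K := K) (fun b => if a ≤ b then 1 else 0) x y i
      simp only [ite_mul, one_mul, zero_mul] at this
      rw [Pi.sub_apply, Finset.sum_apply, Finset.sum_filter, this]
      simp only [le_pmin hxy, comp, vv, Pi.sub_apply]
      fin_cases i <;> by_cases hx : a ≤ x <;> by_cases hy : a ≤ y <;> simp [hx, hy]
    intro v hv
    rw [mem_annih_rel] at hv
    have h4 : ∑ a, v (a, 0, a) • ww K a ∈ S :=
      Submodule.sum_mem _ fun a _ => Submodule.smul_mem _ _ (h3 a)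
    rw [← Submodule.sub_mem_iff_left S h4]
    apply h2
    intro x i y hxy
    have := sum_ww (K := K) (fun b => v (b, 0, b)) x y i
    simp only [Pi.sub_apply, Finset.sum_apply, Pi.smul_apply, smul_eq_mul]
    rw [this]
    have e1 := hv x y hxy
    have e2 := (hv (pmin x y) (pmin x y) (Or.inl le_rfl)).1
    rw [pmin_self'] at e2
    fin_cases i
    · simp; linear_combination e1.1 - e2
    · simp; linear_combination e1.2
  · rw [Submodule.span_le]
    rintro z (⟨a, rfl⟩ | ⟨c, d, hcd, h⟩)
    · rw [SetLike.mem_coe, mem_annih_rel]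
      intro x y hxy
      have := le_pmin (a := a) hxy
      simp only [comp, vv, Pi.sub_apply, this]
      by_cases hx : a ≤ x <;> by_cases hy : a ≤ y <;> simp [hx, hy]
    · rw [SetLike.mem_coe, mem_annih_rel]
      have key : ∀ x y : Q, (x ≤ y ∨ y ≤ x) → vv K c x * vv K d y = 0 := by
        intro x y hxy
        by_cases hx : c ≤ x <;> by_cases hy : d ≤ y <;> simp [vv, hx, hy]
        rcases hxy with h | h
        · rcases hQ c d y (hx.trans h) hy with h | h
          exacts [hcd.1 h, hcd.2 h]
        · rcases hQ c d x hx (hy.trans h) with h | h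
          exacts [hcd.1 h, hcd.2 h]
      intro x y hxy
      have k1 := key x y hxy
      have k2 := key (pmin x y) (pmin x y) (Or.inl le_rfl)
      rcases h with rfl | rfl <;> simp only [comp] <;> rw [k1, k2] <;> simp
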